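/- arXiv:1906.08083 — 4 statements merged into one kernel-verified Lean document; each statement's English description precedes it below -/
import Mathlib

section
/- Let p and q be distinct odd primes with p dividing q − 1. For every integer ℓ with 0 ≤ ℓ < q there exists an integer t with 0 ≤ t < pq², gcd(t, pq) = 1, and ψ(t) ≡ p·ℓ (mod pq); that is, the Euler quotient map ψ from the units modulo pq² onto the subgroup pZ_{pq} = {p·ℓ mod pq : 0 ≤ ℓ < q} of the additive group Z/pqZ is surjective. -/
/-- Euler quotient modulo `p*q`: for `gcd(t, pq) = 1` it is the unique integer in
`{0, ..., pq-1}` congruent to `(t^((p-1)(q-1)) - 1)/(pq)` modulo `pq`; it is `0` otherwise. -/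
def eulerQuotient (p q t : ℕ) : ℕ :=
  if Nat.gcd t (p * q) = 1 then ((t ^ ((p - 1) * (q - 1)) - 1) / (p * q)) % (p * q) else 0

/-- The binary threshold sequence over `F₂`: `s t = 0` if `ψ(t)/(pq) < 1/2`, else `1`. -/
def binSeq (p q t : ℕ) : ZMod 2 :=
  if 2 * eulerQuotient p q t < p * q then 0 else 1

/-- `D ℓ = { t : 0 ≤ t < pq², gcd(t, pq) = 1, ψ(t) ≡ p·ℓ (mod pq) }`. -/
def Dset (p q ℓ : ℕ) : Finset ℕ :=
  (Finset.range (p * q ^ 2)).filter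
    (fun t => Nat.gcd t (p * q) = 1 ∧ eulerQuotient p q t ≡ p * ℓ [MOD p * q])

/-- On the residue class of `1` modulo `p * q` the Euler quotient is linear. -/
theorem eulerQuotient_one_add_mul (p q k : ℕ) (h : 0 < p * q) :
    eulerQuotient p q (1 + p * q * k) ≡ (p - 1) * (q - 1) * k [MOD p * q] := by
  have hgcd : Nat.gcd (1 + p * q * k) (p * q) = 1 := by simp
  obtain ⟨m, hm⟩ := Polynomial.powAddExpansion 1 (p * q * k) ((p - 1) * (q - 1))
  have hpow : (1 + p * q * k) ^ ((p - 1) * (q - 1)) - 1 =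
      p * q * ((p - 1) * (q - 1) * k + p * q * (m * k ^ 2)) := by
    rw [hm, one_pow, one_pow, Nat.cast_id, add_assoc, Nat.add_sub_cancel_left]
    ring
  rw [eulerQuotient, if_pos hgcd, hpow, Nat.mul_div_cancel_left _ h]
  exact (Nat.mod_modEq _ _).trans (by simp [Nat.ModEq])

/-- A linear congruence with invertible leading coefficient has a reduced solution. -/
theorem Nat.Coprime.exists_lt_mul_modEq {a n : ℕ} (h : a.Coprime n) (hn : 0 < n) (b : ℕ) :
    ∃ k < n, a * k ≡ b [MOD n] := by
  have : NeZero n := ⟨hn.ne'⟩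
  refine ⟨((a : ZMod n)⁻¹ * b).val, ZMod.val_lt _, ?_⟩
  rw [← ZMod.natCast_eq_natCast_iff]
  rw [Nat.cast_mul, ZMod.natCast_zmod_val, ← mul_assoc, ZMod.coe_mul_inv_eq_one a h, one_mul]

theorem stmt_4 (p q : ℕ) (hp : p.Prime) (hq : q.Prime) (hpodd : Odd p) (hqodd : Odd q)
    (hne : p ≠ q) (hdvd : p ∣ q - 1) :
    ∀ ℓ : ℕ, ℓ < q → ∃ t : ℕ, t < p * q ^ 2 ∧ Nat.gcd t (p * q) = 1 ∧
      eulerQuotient p q t ≡ p * ℓ [MOD p * q] := by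
  intro ℓ _
  obtain ⟨c, hc⟩ := hdvd
  have hp2 := hp.two_le
  have hq2 := hq.two_le
  have hp_lt : p < q := by
    have := Nat.le_of_dvd (by omega) (Dvd.intro c hc.symm)
    omega
  have hc0 : 0 < c := Nat.pos_of_ne_zero (by rintro rfl; omega)
  have hc_lt : c < q := by
    have := Nat.le_mul_of_pos_left c hp.pos
    omega
  have hcop : ((p - 1) * c).Coprime q :=
    Nat.Coprime.mul_left
      (Nat.coprime_of_lt_prime (by omega) (by omega) hq).symm
      (Nat.coprime_of_lt_prime hc0.ne' hc_lt hq).symm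
  obtain ⟨k, hk, hkℓ⟩ := hcop.exists_lt_mul_modEq hq.pos ℓ
  have hpq : 1 < p * q := by nlinarith
  refine ⟨1 + p * q * k, by nlinarith, by simp, ?_⟩
  refine (eulerQuotient_one_add_mul p q k (by omega)).trans ?_
  rw [hc, show (p - 1) * (p * c) * k = p * ((p - 1) * c * k) by ring]
  exact hkℓ.mul_left' p
end

section
/- Let p and q be distinct odd primes with p dividing q − 1. For every ℓ with 0 ≤ ℓ < q and every integer a with 1 ≤ a < q (so gcd(a, q) = 1), the number of elements u ∈ D_ℓ with u ≡ a (mod q) is exactly p − 1. -/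
/-- Hensel lifting for `x ^ N = c` from modulus `q` to modulus `q ^ 2`: when `q` divides neither
`N` nor `a`, the solutions above `a` form a single residue class. -/
theorem Int.exists_forall_modEq_sq_iff_pow_modEq {q N : ℕ} {a c : ℤ} (hq : q.Prime)
    (ha : ¬ (q : ℤ) ∣ a) (hN : ¬ q ∣ N) (hc : a ^ N ≡ c [ZMOD q]) :
    ∃ x : ℤ, ∀ u : ℤ, (u ≡ a [ZMOD q] ∧ u ^ N ≡ c [ZMOD q ^ 2]) ↔ u ≡ x [ZMOD q ^ 2] := by
  have hqp : Prime (q : ℤ) := Nat.prime_iff_prime_int.mp hq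
  have hq0 : (q : ℤ) ≠ 0 := hqp.ne_zero
  have hB : ¬ (q : ℤ) ∣ (N : ℤ) * a ^ (N - 1) := by
    rw [hqp.dvd_mul, not_or]
    exact ⟨by exact_mod_cast hN, fun h => ha (hqp.dvd_of_dvd_pow h)⟩
  obtain ⟨s, b, hsb⟩ := (Prime.coprime_iff_not_dvd hqp).mpr hB
  obtain ⟨m, hm⟩ := hc.dvd
  have lift_iff (k : ℤ) : (a + q * k) ^ N ≡ c [ZMOD q ^ 2] ↔ (q : ℤ) ∣ b * m - k := by
    obtain ⟨r, hr⟩ := Polynomial.powAddExpansion a (q * k) N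
    have hexp : c - (a + q * k) ^ N
        = q * (m - N * a ^ (N - 1) * k) + (q : ℤ) ^ 2 * (-(r * k ^ 2)) := by
      rw [hr]; linear_combination hm
    rw [Int.modEq_iff_dvd, hexp, dvd_add_left (dvd_mul_right _ _), sq, mul_dvd_mul_iff_left hq0]
    constructor
    · rintro ⟨d, hd⟩
      exact ⟨b * d - s * k, by linear_combination b * hd + k * hsb⟩
    · rintro ⟨d, hd⟩
      exact ⟨N * a ^ (N - 1) * d + s * m, by
        linear_combination N * a ^ (N - 1) * hd - m * hsb⟩
  refine ⟨a + q * (b * m), fun u => ⟨?_, fun h => ?_⟩⟩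
  · rintro ⟨hua, huc⟩
    obtain ⟨k, hk⟩ := hua.symm.dvd
    obtain rfl : u = a + q * k := by linarith
    rw [Int.modEq_iff_dvd, sq,
      show a + q * (b * m) - (a + q * k) = q * (b * m - k) by ring]
    exact mul_dvd_mul_left _ ((lift_iff k).mp huc)
  · obtain ⟨k, hk⟩ := h.symm.dvd
    obtain rfl : u = a + q * (b * m + q * k) := by linear_combination hk
    refine ⟨?_, (lift_iff _).mpr ⟨-k, by ring⟩⟩
    exact (Int.modEq_iff_dvd.mpr ⟨-(b * m + q * k), by ring⟩)

/-- For `t` coprime to `p * q`, the condition `ψ(t) ≡ p * ℓ` modulo `p * q` only depends on `t`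
modulo `q ^ 2`. -/
theorem eulerQuotient_modEq_iff {p q t : ℕ} (hp : p.Prime) (hq : q.Prime) (hne : p ≠ q)
    (hdvd : p ∣ q - 1) (ℓ : ℕ) (ht : t.Coprime (p * q)) :
    eulerQuotient p q t ≡ p * ℓ [MOD p * q] ↔
      t ^ ((p - 1) * (q - 1)) ≡ 1 + p ^ 2 * q * ℓ [MOD q ^ 2] := by
  obtain ⟨htp, htq⟩ := Nat.coprime_mul_iff_right.mp ht
  have hpq : p.Coprime q := (Nat.coprime_primes hp hq).mpr hne
  have hmodp : t ^ ((p - 1) * (q - 1)) ≡ 1 [MOD p ^ 2] := by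
    obtain ⟨d, hd⟩ := hdvd
    have h := (Nat.ModEq.pow_totient (htp.pow_right 2)).pow d
    rw [Nat.totient_prime_pow hp two_pos, one_pow, ← pow_mul] at h
    convert h using 2
    rw [hd]
    norm_num
    ring
  have hmodq : t ^ ((p - 1) * (q - 1)) ≡ 1 [MOD q] := by
    have h := (Nat.ModEq.pow_totient htq).pow (p - 1)
    rwa [Nat.totient_prime hq, one_pow, ← pow_mul, mul_comm (q - 1)] at h
  have hpos : 1 ≤ t ^ ((p - 1) * (q - 1)) := by
    refine Nat.one_le_pow _ _ (Nat.pos_of_ne_zero ?_)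
    rintro rfl
    exact hp.one_lt.ne' (by simpa using htp)
  obtain ⟨e, he⟩ : p * q ∣ t ^ ((p - 1) * (q - 1)) - 1 := by
    refine (Nat.modEq_iff_dvd' hpos).mp
      ((Nat.modEq_and_modEq_iff_modEq_mul hpq).mp ⟨?_, hmodq⟩).symm
    exact hmodp.of_dvd (dvd_pow_self p two_ne_zero)
  have hpq0 : 0 < p * q := Nat.mul_pos hp.pos hq.pos
  have hpow : t ^ ((p - 1) * (q - 1)) = 1 + p * q * e := by omega
  have hψ : eulerQuotient p q t = e % (p * q) := by
    rw [eulerQuotient, if_pos ht, he, Nat.mul_div_cancel_left _ hpq0]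
  have hzero : 1 + p ^ 2 * q * ℓ ≡ 1 [MOD p ^ 2] := by
    simp [Nat.ModEq, mul_assoc]
  calc eulerQuotient p q t ≡ p * ℓ [MOD p * q]
      ↔ e ≡ p * ℓ [MOD p * q] := by rw [hψ, Nat.ModEq, Nat.mod_mod, Nat.ModEq]
    _ ↔ p * q * e ≡ p * q * (p * ℓ) [MOD p * q * (p * q)] :=
        ⟨Nat.ModEq.mul_left' _, Nat.ModEq.mul_left_cancel' hpq0.ne'⟩
    _ ↔ 1 + p * q * e ≡ 1 + p * q * (p * ℓ) [MOD p * q * (p * q)] :=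
        ⟨Nat.ModEq.add_left 1, Nat.ModEq.add_left_cancel' 1⟩
    _ ↔ t ^ ((p - 1) * (q - 1)) ≡ 1 + p ^ 2 * q * ℓ [MOD p ^ 2 * q ^ 2] := by
        rw [hpow, show p * q * (p * q) = p ^ 2 * q ^ 2 by ring,
          show p * q * (p * ℓ) = p ^ 2 * q * ℓ by ring]
    _ ↔ t ^ ((p - 1) * (q - 1)) ≡ 1 + p ^ 2 * q * ℓ [MOD q ^ 2] := by
        rw [← Nat.modEq_and_modEq_iff_modEq_mul (hpq.pow 2 2)]
        exact and_iff_right (hmodp.trans hzero.symm)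

/-- The members of a residue class modulo `m` below `p * m` that are not divisible by the prime
`p`, where `p` and `m` are coprime, number `p - 1`. -/
theorem Nat.card_filter_not_dvd_and_modEq {p m : ℕ} (hp : p.Prime) (hm : 0 < m)
    (hpm : p.Coprime m) (x : ℕ) :
    ((Finset.range (p * m)).filter (fun u => ¬ p ∣ u ∧ u ≡ x [MOD m])).card = p - 1 := by
  rw [← Nat.card_Ioo 0 p |>.trans (by simp : p - 0 - 1 = p - 1)]
  refine Finset.card_bij (fun u _ => u % p) ?_ ?_ ?_
  · intro u hu
    simp only [Finset.mem_filter, Finset.mem_range] at hu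
    exact Finset.mem_Ioo.mpr
      ⟨Nat.pos_of_ne_zero fun h => hu.2.1 (Nat.dvd_of_mod_eq_zero h), Nat.mod_lt _ hp.pos⟩
  · intro u hu v hv huv
    simp only [Finset.mem_filter, Finset.mem_range] at hu hv
    exact ((Nat.modEq_and_modEq_iff_modEq_mul hpm).mp
      ⟨huv, hu.2.2.trans hv.2.2.symm⟩).eq_of_lt_of_lt hu.1 hv.1
  · intro r hr
    obtain ⟨hr0, hrp⟩ := Finset.mem_Ioo.mp hr
    obtain ⟨hur, hux⟩ := (Nat.chineseRemainder hpm r x).2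
    have hmod : (Nat.chineseRemainder hpm r x : ℕ) % p = r :=
      Eq.trans hur (Nat.mod_eq_of_lt hrp)
    refine ⟨Nat.chineseRemainder hpm r x, ?_, hmod⟩
    simp only [Finset.mem_filter, Finset.mem_range]
    refine ⟨Nat.chineseRemainder_lt_mul hpm r x hp.ne_zero hm.ne', fun h => ?_, hux⟩
    rw [Nat.mod_eq_zero_of_dvd h] at hmod
    omega

theorem stmt_9 (p q : ℕ) (hp : p.Prime) (hq : q.Prime) (hpodd : Odd p) (hqodd : Odd q)
    (hne : p ≠ q) (hdvd : p ∣ q - 1) (ℓ : ℕ) (hℓ : ℓ < q) (a : ℕ) (ha1 : 1 ≤ a)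
    (ha2 : a < q) :
    ((Dset p q ℓ).filter (fun u => u ≡ a [MOD q])).card = p - 1 := by
  have hpq : p.Coprime q := (Nat.coprime_primes hp hq).mpr hne
  have hq1 : 0 < q - 1 := Nat.sub_pos_of_lt hq.one_lt
  have hpq_le : p ≤ q - 1 := Nat.le_of_dvd hq1 hdvd
  have hqa : ¬ q ∣ a := Nat.not_dvd_of_pos_of_lt ha1 ha2
  have hN : ¬ q ∣ (p - 1) * (q - 1) := by
    rw [hq.dvd_mul, not_or]
    have := hp.two_le
    exact ⟨Nat.not_dvd_of_pos_of_lt (by omega) (by omega),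
      Nat.not_dvd_of_pos_of_lt hq1 (by omega)⟩
  have hc : a ^ ((p - 1) * (q - 1)) ≡ 1 + p ^ 2 * q * ℓ [MOD q] := by
    have h := (Nat.ModEq.pow_totient ((hq.coprime_iff_not_dvd.mpr hqa).symm)).pow (p - 1)
    rw [Nat.totient_prime hq, one_pow, ← pow_mul, mul_comm (q - 1)] at h
    refine h.trans (Nat.ModEq.symm ?_)
    simp [Nat.ModEq, mul_right_comm _ q]
  obtain ⟨x, hx⟩ := Int.exists_forall_modEq_sq_iff_pow_modEq hq (a := a)
    (c := ((1 + p ^ 2 * q * ℓ : ℕ) : ℤ)) (by exact_mod_cast hqa) hN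
    (by exact_mod_cast Int.natCast_modEq_iff.mpr hc)
  obtain ⟨y, hy⟩ := Int.eq_ofNat_of_zero_le
    (Int.emod_nonneg x (pow_ne_zero 2 (Int.natCast_ne_zero.mpr hq.ne_zero)))
  have hiff (u : ℕ) : (u ≡ a [MOD q] ∧
      u ^ ((p - 1) * (q - 1)) ≡ 1 + p ^ 2 * q * ℓ [MOD q ^ 2]) ↔ u ≡ y [MOD q ^ 2] := by
    have h := hx u
    rw [show (u : ℤ) ≡ x [ZMOD q ^ 2] ↔ (u : ℤ) ≡ y [ZMOD q ^ 2] by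
      rw [← hy, Int.ModEq, Int.ModEq, Int.emod_emod]] at h
    rw [← Int.natCast_modEq_iff, ← Int.natCast_modEq_iff, ← Int.natCast_modEq_iff]
    exact_mod_cast h
  rw [← Nat.card_filter_not_dvd_and_modEq hp (pow_pos hq.pos 2) (hpq.pow_right 2) y, Dset,
    Finset.filter_filter]
  congr 1
  refine Finset.filter_congr fun u _ => ?_
  rw [← hiff]
  constructor
  · rintro ⟨⟨hgcd, hψ⟩, hua⟩
    exact ⟨hp.coprime_iff_not_dvd.mp (Nat.Coprime.coprime_mul_right_right hgcd).symm, hua,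
      (eulerQuotient_modEq_iff hp hq hne hdvd ℓ hgcd).mp hψ⟩
  · rintro ⟨hpu, hua, hpow⟩
    have hgcd : u.Coprime (p * q) := Nat.Coprime.mul_right
      (hp.coprime_iff_not_dvd.mpr hpu).symm
      (hq.coprime_iff_not_dvd.mpr fun h => hqa ((hua.dvd_iff dvd_rfl).mp h)).symm
    exact ⟨⟨hgcd, (eulerQuotient_modEq_iff hp hq hne hdvd ℓ hgcd).mpr hpow⟩, hua⟩
end

section
/- Let p and q be distinct odd primes with p dividing q − 1. For every ℓ with 0 ≤ ℓ < q, the reduction map u ↦ u mod pq is a bijection from D_ℓ onto the set {a : 0 ≤ a < pq, gcd(a, pq) = 1} of units modulo pq. -/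
lemma pos_of_coprime_prime_mul {p q t : ℕ} (hp : p.Prime) (ht : t.Coprime (p * q)) : 0 < t := by
  refine Nat.pos_of_ne_zero ?_
  rintro rfl
  exact hp.one_lt.ne' (Nat.eq_one_of_mul_eq_one_right ((Nat.coprime_zero_left _).1 ht))

/-- Since `p ∣ q - 1`, the exponent `(p - 1) * (q - 1)` is a multiple of `φ(p²) = p * (p - 1)`. -/
lemma sq_mul_dvd_pow_sub_one {p q t : ℕ} (hp : p.Prime) (hq : q.Prime) (hne : p ≠ q)
    (hdvd : p ∣ q - 1) (ht : t.Coprime (p * q)) :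
    p ^ 2 * q ∣ t ^ ((p - 1) * (q - 1)) - 1 := by
  have hcop : (p ^ 2).Coprime q := ((Nat.coprime_primes hp hq).2 hne).pow_left 2
  have pow_modEq_one {m : ℕ} (hm : t.Coprime m) (h : m.totient ∣ (p - 1) * (q - 1)) :
      1 ≡ t ^ ((p - 1) * (q - 1)) [MOD m] := by
    obtain ⟨c, hc⟩ := h
    simpa [hc, pow_mul] using ((Nat.ModEq.pow_totient hm).pow c).symm
  have hpos := Nat.one_le_pow ((p - 1) * (q - 1)) t (pos_of_coprime_prime_mul hp ht)
  refine hcop.mul_dvd_of_dvd_of_dvd ?_ ?_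
  · refine (Nat.modEq_iff_dvd' hpos).1 (pow_modEq_one (ht.coprime_mul_right_right.pow_right 2) ?_)
    rw [Nat.totient_prime_pow hp two_pos, mul_comm]
    simpa using mul_dvd_mul_left (p - 1) hdvd
  · refine (Nat.modEq_iff_dvd' hpos).1 (pow_modEq_one ht.coprime_mul_left_right ?_)
    rw [Nat.totient_prime hq]
    exact dvd_mul_left _ _

lemma dvd_eulerQuotient {p q t : ℕ} (hp : p.Prime) (hq : q.Prime) (hne : p ≠ q)
    (hdvd : p ∣ q - 1) (ht : t.Coprime (p * q)) : p ∣ eulerQuotient p q t := by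
  rw [eulerQuotient, if_pos ht, Nat.dvd_mod_iff (dvd_mul_right p q)]
  refine Nat.dvd_div_of_mul_dvd ?_
  convert sq_mul_dvd_pow_sub_one hp hq hne hdvd ht using 1
  ring

lemma pow_modEq_one_add_mul_eulerQuotient {p q t : ℕ} (hp : p.Prime) (hq : q.Prime)
    (hne : p ≠ q) (hdvd : p ∣ q - 1) (ht : t.Coprime (p * q)) :
    t ^ ((p - 1) * (q - 1)) ≡ 1 + p * q * eulerQuotient p q t [MOD p * q * (p * q)] := by
  have hdiv : p * q ∣ t ^ ((p - 1) * (q - 1)) - 1 :=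
    (Dvd.intro_left p (by ring)).trans (sq_mul_dvd_pow_sub_one hp hq hne hdvd ht)
  have hpos := Nat.one_le_pow ((p - 1) * (q - 1)) t (pos_of_coprime_prime_mul hp ht)
  rw [eulerQuotient, if_pos ht]
  calc t ^ ((p - 1) * (q - 1))
      = 1 + p * q * ((t ^ ((p - 1) * (q - 1)) - 1) / (p * q)) := by
        rw [Nat.mul_div_cancel' hdiv]; omega
    _ ≡ _ [MOD p * q * (p * q)] := ((Nat.mod_modEq _ _).symm.mul_left' _).add_left 1

/-- Raising to a power prime to `q` is injective on each residue class of units modulo `q`,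
when read modulo `q²`. -/
lemma modEq_sq_of_pow_modEq_sq {q u v n : ℕ} (hq : q.Prime) (hu : ¬ q ∣ u) (hn : ¬ q ∣ n)
    (huv : u ≡ v [MOD q]) (hpow : u ^ n ≡ v ^ n [MOD q ^ 2]) : u ≡ v [MOD q ^ 2] := by
  have h := emultiplicity_pow_sub_pow_of_prime (Nat.prime_iff_prime_int.1 hq)
    (x := (u : ℤ)) (y := v) (Nat.modEq_iff_dvd.1 huv.symm) (by exact_mod_cast hu)
    (n := n) (by exact_mod_cast hn)
  have h2 := Nat.modEq_iff_dvd.1 hpow.symm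
  push_cast at h2
  refine (Nat.modEq_iff_dvd.2 ?_).symm
  push_cast
  rw [pow_dvd_iff_le_emultiplicity] at h2 ⊢
  rwa [← h]

lemma eq_of_eulerQuotient_modEq {p q u v : ℕ} (hp : p.Prime) (hq : q.Prime) (hne : p ≠ q)
    (hdvd : p ∣ q - 1) (hu : u.Coprime (p * q)) (hv : v.Coprime (p * q))
    (hult : u < p * q ^ 2) (hvlt : v < p * q ^ 2) (huv : u ≡ v [MOD p * q])
    (hQ : eulerQuotient p q u ≡ eulerQuotient p q v [MOD q]) : u = v := by
  have hpq : p < q := by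
    have := Nat.le_of_dvd (Nat.sub_pos_of_lt hq.one_lt) hdvd
    have := hq.pos
    omega
  have hexp : ¬ q ∣ (p - 1) * (q - 1) := by
    have := hp.one_lt
    rw [hq.dvd_mul, not_or]
    exact ⟨Nat.not_dvd_of_pos_of_lt (by omega) (by omega),
      Nat.not_dvd_of_pos_of_lt (by omega) (by omega)⟩
  have hsq : q ^ 2 ∣ p * q * (p * q) := Dvd.intro_left (p ^ 2) (by ring)
  have hpow : u ^ ((p - 1) * (q - 1)) ≡ v ^ ((p - 1) * (q - 1)) [MOD q ^ 2] := by
    have hmul : p * q * eulerQuotient p q u ≡ p * q * eulerQuotient p q v [MOD q ^ 2] :=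
      (hQ.mul_left' (p * q)).of_dvd (Dvd.intro_left p (by ring))
    exact ((pow_modEq_one_add_mul_eulerQuotient hp hq hne hdvd hu).of_dvd hsq).trans
      ((hmul.add_left 1).trans
        ((pow_modEq_one_add_mul_eulerQuotient hp hq hne hdvd hv).of_dvd hsq).symm)
  have hqu : ¬ q ∣ u := fun h ↦
    hq.one_lt.ne' (Nat.eq_one_of_dvd_coprimes hu h (dvd_mul_left q p))
  have hmod : u ≡ v [MOD q ^ 2] := modEq_sq_of_pow_modEq_sq hq hqu hexp
    (huv.of_dvd (dvd_mul_left q p)) hpow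
  have hcop : p.Coprime (q ^ 2) := ((Nat.coprime_primes hp hq).2 hne).pow_right 2
  exact ((Nat.modEq_and_modEq_iff_modEq_mul hcop).1
    ⟨huv.of_dvd (dvd_mul_right p q), hmod⟩).eq_of_lt_of_lt hult hvlt

theorem stmt_10 (p q : ℕ) (hp : p.Prime) (hq : q.Prime) (hpodd : Odd p) (hqodd : Odd q)
    (hne : p ≠ q) (hdvd : p ∣ q - 1) (ℓ : ℕ) (hℓ : ℓ < q) :
    (Dset p q ℓ).image (fun u => u % (p * q)) =
        (Finset.range (p * q)).filter (fun a => Nat.gcd a (p * q) = 1) ∧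
      Set.InjOn (fun u => u % (p * q)) (Dset p q ℓ : Set ℕ) := by
  have hpq : 0 < p * q := Nat.mul_pos hp.pos hq.pos
  refine ⟨?_, ?_⟩
  · ext a
    simp only [Finset.mem_image, Finset.mem_filter, Finset.mem_range, Dset]
    constructor
    · rintro ⟨u, ⟨-, hu, -⟩, rfl⟩
      exact ⟨Nat.mod_lt _ hpq, by rw [(Nat.mod_modEq u (p * q)).gcd_eq, hu]⟩
    · rintro ⟨ha, hcop⟩
      have hmod (k : ℕ) : a + p * q * k ≡ a [MOD p * q] := by simp [Nat.ModEq]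
      have hlt {k : ℕ} (hk : k < q) : a + p * q * k < p * q ^ 2 :=
        calc a + p * q * k < p * q * (k + 1) := by linarith
          _ ≤ p * q * q := Nat.mul_le_mul_left _ hk
          _ = p * q ^ 2 := by ring
      have hcop' (k : ℕ) : (a + p * q * k).Coprime (p * q) := by
        rw [Nat.Coprime, (hmod k).gcd_eq, hcop]
      have : NeZero q := ⟨hq.ne_zero⟩
      let f : Fin q → ZMod q := fun k ↦ (eulerQuotient p q (a + p * q * k) : ZMod q)
      have hinj : f.Injective := by
        intro k k' hkk'
        have h := eq_of_eulerQuotient_modEq hp hq hne hdvd (hcop' k) (hcop' k')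
          (hlt k.2) (hlt k'.2) ((hmod k).trans (hmod k').symm)
          ((ZMod.natCast_eq_natCast_iff _ _ _).1 hkk')
        exact Fin.ext (Nat.eq_of_mul_eq_mul_left hpq (Nat.add_left_cancel h))
      have hbij := (Fintype.bijective_iff_injective_and_card f).2 ⟨hinj, by simp [ZMod.card]⟩
      obtain ⟨k, hk⟩ := hbij.surjective ((p * ℓ : ℕ) : ZMod q)
      refine ⟨a + p * q * k, ⟨hlt k.2, hcop' k, ?_⟩, ?_⟩
      · refine (Nat.modEq_and_modEq_iff_modEq_mul ((Nat.coprime_primes hp hq).2 hne)).1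
          ⟨?_, (ZMod.natCast_eq_natCast_iff _ _ _).1 hk⟩
        exact (Nat.modEq_zero_iff_dvd.2 (dvd_eulerQuotient hp hq hne hdvd (hcop' k))).trans
          (Nat.modEq_zero_iff_dvd.2 (dvd_mul_right p ℓ)).symm
      · exact Eq.trans (hmod k) (Nat.mod_eq_of_lt ha)
  · intro u hu v hv huv
    simp only [Dset, Finset.coe_filter, Finset.mem_range, Set.mem_ofPred_eq] at hu hv
    exact eq_of_eulerQuotient_modEq hp hq hne hdvd hu.2.1 hv.2.1 hu.1 hv.1 huv
      ((hu.2.2.trans hv.2.2.symm).of_dvd (dvd_mul_left q p))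
end

section
/- Let p and q be distinct odd primes with p dividing q − 1. Let K be a field of characteristic 2 and γ ∈ K a primitive pq²-th root of unity (such γ exists in the algebraic closure of F₂ since pq² is odd). Then for every ℓ with 0 ≤ ℓ < q and every integer v with 0 ≤ v < pq²: if gcd(v, pq²) = q then Σ_{u ∈ D_ℓ} γ^{u·v} = 1, and if gcd(v, pq²) ∈ {p, pq, q²} then Σ_{u ∈ D_ℓ} γ^{u·v} = 0. -/
theorem mem_Dset_iff {p q : ℕ} (hp : p.Prime) (hq : q.Prime) (hne : p ≠ q) (hdvd : p ∣ q - 1)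
    (ℓ t : ℕ) :
    t ∈ Dset p q ℓ ↔ t < p * q ^ 2 ∧ t.Coprime (p * q) ∧
      (t : ZMod (q ^ 2)) ^ ((p - 1) * (q - 1)) = 1 + p ^ 2 * q * ℓ := by
  have hcop : p.Coprime q := (Nat.coprime_primes hp hq).2 hne
  unfold Dset eulerQuotient
  rw [Finset.mem_filter, Finset.mem_range]
  refine and_congr_right fun _ => and_congr_right fun ht => ?_
  rw [if_pos ht]
  have htp : t.Coprime p := Nat.Coprime.coprime_mul_right_right ht
  have htq : t.Coprime q := Nat.Coprime.coprime_mul_left_right ht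
  have ht0 : 0 < t := by
    rcases Nat.eq_zero_or_pos t with rfl | h
    · exact absurd ((Nat.coprime_zero_left _).1 htp) hp.ne_one
    · exact h
  have hX1 : 1 ≤ t ^ ((p - 1) * (q - 1)) := Nat.one_le_pow _ _ ht0
  have hpp : p ^ 2 ∣ t ^ ((p - 1) * (q - 1)) - 1 := by
    obtain ⟨c, hc⟩ := hdvd
    have h := (Nat.ModEq.pow_totient (htp.pow_right 2)).pow c
    rw [one_pow, ← pow_mul, Nat.totient_prime_pow hp two_pos] at h
    have e : p ^ (2 - 1) * (p - 1) * c = (p - 1) * (q - 1) := by rw [hc]; simp; ring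
    rw [e] at h
    exact (Nat.modEq_iff_dvd' hX1).1 h.symm
  have hqd : q ∣ t ^ ((p - 1) * (q - 1)) - 1 := by
    have h := (Nat.ModEq.pow_totient htq).pow (p - 1)
    rw [one_pow, ← pow_mul, Nat.totient_prime hq, mul_comm] at h
    exact (Nat.modEq_iff_dvd' hX1).1 h.symm
  obtain ⟨Y, hY⟩ := hcop.mul_dvd_of_dvd_of_dvd ((dvd_pow_self p two_ne_zero).trans hpp) hqd
  have hpY : p ∣ Y := by
    rw [hY, pow_two, mul_assoc] at hpp
    exact hcop.dvd_of_dvd_mul_left (Nat.dvd_of_mul_dvd_mul_left hp.pos hpp)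
  have hX : t ^ ((p - 1) * (q - 1)) = 1 + p * q * Y := by omega
  have hcast : ((t : ZMod (q ^ 2)) ^ ((p - 1) * (q - 1)) = 1 + p ^ 2 * q * ℓ) ↔
      1 + p * q * Y ≡ 1 + p ^ 2 * q * ℓ [MOD q ^ 2] := by
    rw [← ZMod.natCast_eq_natCast_iff, ← hX]
    push_cast
    rfl
  have e₁ : p * q * Y = q * (p * Y) := by ring
  have e₂ : p ^ 2 * q * ℓ = q * (p * (p * ℓ)) := by ring
  rw [hcast, hY, Nat.mul_div_cancel_left _ (Nat.mul_pos hp.pos hq.pos), e₁, e₂, pow_two,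
    Nat.ModEq, Nat.mod_mod, ← Nat.ModEq, ← Nat.modEq_and_modEq_iff_modEq_mul hcop]
  have hYp : Y ≡ p * ℓ [MOD p] :=
    ((Nat.modEq_zero_iff_dvd).2 hpY).trans ((Nat.modEq_zero_iff_dvd).2 (dvd_mul_right _ _)).symm
  constructor
  · rintro ⟨-, h⟩
    exact ((h.mul_left p).mul_left' q).add_left 1
  · intro h
    refine ⟨hYp, ?_⟩
    have h' := Nat.ModEq.mul_left_cancel' hq.ne_zero (Nat.ModEq.add_left_cancel' 1 h)
    exact Nat.ModEq.cancel_left_of_coprime (by simpa using hcop.symm) h'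

/-- In characteristic two, a sum of powers over residues vanishes when the residues are permuted
without fixed points by multiplication by a square root of `1`. -/
theorem sum_pow_eq_zero_of_involution {K : Type*} [Field K] [CharP K 2] {N c : ℕ} {ω : K}
    {S : Finset ℕ} (hω : ω ^ N = 1) (hωc : ω ^ c = ω) (hc : c * c ≡ 1 [MOD N])
    (hlt : ∀ u ∈ S, u < N) (hmem : ∀ u ∈ S, u * c % N ∈ S) (hfix : ∀ u ∈ S, u * c % N ≠ u) :
    ∑ u ∈ S, ω ^ u = 0 := by
  refine Finset.sum_involution (fun u _ => u * c % N) (fun u _ => ?_) (fun u hu _ => hfix u hu)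
    hmem (fun u hu => ?_)
  · rw [← pow_mod_orderOf ω (u * c % N), Nat.mod_mod_of_dvd _ (orderOf_dvd_of_pow_eq_one hω),
      pow_mod_orderOf, mul_comm, pow_mul, hωc, CharTwo.add_self_eq_zero]
  · have h : u * c % N * c ≡ u [MOD N] := by
      calc u * c % N * c ≡ u * c * c [MOD N] := (Nat.mod_modEq _ _).mul_right c
        _ = u * (c * c) := mul_assoc _ _ _
        _ ≡ u * 1 [MOD N] := hc.mul_left u
        _ = u := mul_one u
    exact Nat.mod_eq_of_modEq h (hlt u hu)

theorem IsPrimitiveRoot.sum_pow_filter_dvd_eq_zero {K : Type*} [Field K] {d e : ℕ} {ω : K}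
    (hω : IsPrimitiveRoot ω (d * e)) (hd : 0 < d) (he : 1 < e) :
    ∑ r ∈ (Finset.range (d * e)).filter (d ∣ ·), ω ^ r = 0 := by
  rw [← (hω.pow (by positivity) rfl).geom_sum_eq_zero he]
  refine (Finset.sum_nbij (fun k => d * k) ?_ ?_ ?_ ?_).symm
  · intro k hk
    simpa [hd] using hk
  · intro a _ b _ h
    exact Nat.eq_of_mul_eq_mul_left hd h
  · intro r hr
    simp only [Finset.coe_filter, Finset.mem_range, Set.mem_ofPred_eq] at hr
    obtain ⟨h, k, rfl⟩ := hr
    exact ⟨k, by simpa using Nat.lt_of_mul_lt_mul_left h, rfl⟩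
  · intro k _
    rw [pow_mul]

theorem IsPrimitiveRoot.sum_pow_filter_coprime_mul_primes {K : Type*} [Field K] {p q : ℕ}
    (hp : p.Prime) (hq : q.Prime) (hne : p ≠ q) {ω : K} (hω : IsPrimitiveRoot ω (p * q)) :
    ∑ r ∈ (Finset.range (p * q)).filter (Nat.Coprime · (p * q)), ω ^ r = 1 := by
  have hcop : p.Coprime q := (Nat.coprime_primes hp hq).2 hne
  have hpq : 0 < p * q := Nat.mul_pos hp.pos hq.pos
  have h1 : 1 < p * q := one_lt_mul'' hp.one_lt hq.one_lt
  have hsp := hω.sum_pow_filter_dvd_eq_zero hp.pos hq.one_lt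
  have hsq := (mul_comm p q ▸ hω).sum_pow_filter_dvd_eq_zero hq.pos hp.one_lt
  have hsa := hω.geom_sum_eq_zero h1
  have hs0 : ∑ r ∈ (Finset.range (p * q)).filter (p * q ∣ ·), ω ^ r = 1 := by
    rw [Finset.sum_eq_single 0]
    · simp
    · intro r hr hr0
      simp only [Finset.mem_filter, Finset.mem_range] at hr
      exact absurd (Nat.eq_zero_of_dvd_of_lt hr.2 hr.1) hr0
    · simp [hp.ne_zero, hq.ne_zero]
  rw [mul_comm q p] at hsq
  rw [Finset.sum_filter] at hsp hsq hs0 ⊢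
  have key : ∀ r, (if r.Coprime (p * q) then ω ^ r else 0) =
      ω ^ r - (if p ∣ r then ω ^ r else 0) - (if q ∣ r then ω ^ r else 0) +
        (if p * q ∣ r then ω ^ r else 0) := by
    intro r
    have a : r.Coprime (p * q) ↔ ¬ p ∣ r ∧ ¬ q ∣ r := by
      rw [Nat.coprime_mul_iff_right, Nat.coprime_comm, hp.coprime_iff_not_dvd,
        Nat.coprime_comm, hq.coprime_iff_not_dvd]
    have b : p * q ∣ r ↔ p ∣ r ∧ q ∣ r :=
      ⟨fun h => ⟨(dvd_mul_right _ _).trans h, (dvd_mul_left _ _).trans h⟩,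
        fun h => hcop.mul_dvd_of_dvd_of_dvd h.1 h.2⟩
    simp only [a, b]
    by_cases hpr : p ∣ r <;> by_cases hqr : q ∣ r <;> simp [hpr, hqr]
  simp only [key, Finset.sum_add_distrib, Finset.sum_sub_distrib, hsp, hsq, hs0, hsa]
  ring

theorem mul_mod_mem_Dset {p q : ℕ} (hp : p.Prime) (hq : q.Prime) (hpodd : Odd p) (hne : p ≠ q)
    (hdvd : p ∣ q - 1) {ℓ u c : ℕ} (hcN : c.Coprime (p * q))
    (hc : (c : ZMod (q ^ 2)) = 1 ∨ (c : ZMod (q ^ 2)) = -1) (hu : u ∈ Dset p q ℓ) :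
    u * c % (p * q ^ 2) ∈ Dset p q ℓ := by
  rw [mem_Dset_iff hp hq hne hdvd] at hu ⊢
  obtain ⟨-, hu, hpow⟩ := hu
  have hN : 0 < p * q ^ 2 := Nat.mul_pos hp.pos (pow_pos hq.pos 2)
  refine ⟨Nat.mod_lt _ hN, ?_, ?_⟩
  · have h : u * c % (p * q ^ 2) ≡ u * c [MOD p * q] :=
      (Nat.mod_modEq _ _).of_dvd ⟨q, by ring⟩
    exact h.gcd_eq.trans (hu.mul_left hcN)
  · have h : ((u * c % (p * q ^ 2) : ℕ) : ZMod (q ^ 2)) = u * c := by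
      rw [← Nat.cast_mul, ZMod.natCast_eq_natCast_iff]
      exact (Nat.mod_modEq _ _).of_dvd (dvd_mul_left _ _)
    have heven : Even ((p - 1) * (q - 1)) := (Nat.Odd.sub_odd hpodd odd_one).mul_right _
    rw [h, mul_pow, hpow]
    rcases hc with hc | hc <;> simp [hc, heven.neg_one_pow]

theorem sum_Dset_pow_eq_zero {p q : ℕ} (hp : p.Prime) (hq : q.Prime) (hpodd : Odd p)
    (hqodd : Odd q) (hne : p ≠ q) (hdvd : p ∣ q - 1) {K : Type*} [Field K] [CharP K 2] {ω : K}
    (hω : ω ^ p = 1 ∨ ω ^ q ^ 2 = 1) (ℓ : ℕ) : ∑ u ∈ Dset p q ℓ, ω ^ u = 0 := by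
  have hcop : p.Coprime q := (Nat.coprime_primes hp hq).2 hne
  have hcop2 : p.Coprime (q ^ 2) := hcop.pow_right 2
  have hmem := mem_Dset_iff hp hq hne hdvd ℓ
  have hp1 := hp.one_lt
  have hq1 : 1 < q ^ 2 := Nat.one_lt_pow two_ne_zero hq.one_lt
  have key : ∀ m n c : ℕ, m * n = p * q ^ 2 → ω ^ m = 1 → m.Coprime n → 1 < n → Odd n →
      c ≡ 1 [MOD m] → (c : ZMod n) = -1 → c.Coprime (p * q) →
      (∀ u ∈ Dset p q ℓ, u.Coprime n) →
      ((c : ZMod (q ^ 2)) = 1 ∨ (c : ZMod (q ^ 2)) = -1) → ∑ u ∈ Dset p q ℓ, ω ^ u = 0 := by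
    intro m n c hmn hm hmc hn hodd hcm hcn hcN hun hcq
    have hc2 : c * c ≡ 1 [MOD p * q ^ 2] := by
      rw [← hmn, ← Nat.modEq_and_modEq_iff_modEq_mul hmc]
      refine ⟨hcm.mul hcm, ?_⟩
      rw [← ZMod.natCast_eq_natCast_iff]
      push_cast
      rw [hcn]
      ring
    have hωc : ω ^ c = ω := by
      rw [← pow_mod_orderOf, hcm.of_dvd (orderOf_dvd_of_pow_eq_one hm), pow_mod_orderOf, pow_one]
    refine sum_pow_eq_zero_of_involution (N := p * q ^ 2) (c := c)
      (by rw [← hmn, pow_mul, hm, one_pow]) hωc hc2 (fun u hu => ((hmem u).1 hu).1)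
      (fun u hu => mul_mod_mem_Dset hp hq hpodd hne hdvd hcN hcq hu) (fun u hu h => ?_)
    have h1 : u * c ≡ u [MOD n] := by
      have h2 : u * c % (p * q ^ 2) ≡ u * c [MOD n] :=
        (Nat.mod_modEq _ _).of_dvd (hmn ▸ dvd_mul_left _ _)
      rw [h] at h2
      exact h2.symm
    have h2 : ((2 * u : ℕ) : ZMod n) = 0 := by
      rw [← ZMod.natCast_eq_natCast_iff] at h1
      push_cast at h1 ⊢
      rw [hcn] at h1
      linear_combination -h1
    rw [ZMod.natCast_eq_zero_iff] at h2
    have h3 : n ∣ 1 := by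
      have := (hun u hu).symm.dvd_of_dvd_mul_right h2
      exact (Nat.coprime_two_left.2 hodd).symm.dvd_of_dvd_mul_right (by simpa using this)
    exact absurd (Nat.dvd_one.1 h3) hn.ne'
  have hneg : ∀ {n c : ℕ}, 1 < n → c ≡ n - 1 [MOD n] → (c : ZMod n) = -1 := by
    intro n c hn h
    rw [(ZMod.natCast_eq_natCast_iff _ _ _).2 h, Nat.cast_sub hn.le]
    simp
  have hunit : ∀ {n c : ℕ}, (c : ZMod n) = -1 → c.Coprime n := fun h =>
    (ZMod.isUnit_iff_coprime _ _).1 (h ▸ isUnit_one.neg)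
  have hunit1 : ∀ {n c : ℕ}, c ≡ 1 [MOD n] → c.Coprime n := fun h => by
    simpa using h.gcd_eq
  have hqq : ∀ {c : ℕ}, c.Coprime (q ^ 2) → c.Coprime q :=
    fun h => h.coprime_dvd_right (dvd_pow_self q two_ne_zero)
  rcases hω with hω | hω
  · obtain ⟨c, hc1, hc2⟩ := Nat.chineseRemainder hcop2 1 (q ^ 2 - 1)
    have hc3 := hneg hq1 hc2
    exact key p (q ^ 2) c rfl hω hcop2 hq1 (hqodd.pow) hc1 hc3
      ((hunit1 hc1).mul_right (hqq (hunit hc3)))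
      (fun u hu => (((hmem u).1 hu).2.1.coprime_mul_left_right).pow_right 2) (Or.inr hc3)
  · obtain ⟨c, hc1, hc2⟩ := Nat.chineseRemainder hcop2.symm 1 (p - 1)
    have hc3 := hneg hp1 hc2
    refine key (q ^ 2) p c (mul_comm _ _) hω hcop2.symm hp1 hpodd hc1 hc3
      ((hunit hc3).mul_right (hqq (hunit1 hc1)))
      (fun u hu => ((hmem u).1 hu).2.1.coprime_mul_right_right) (Or.inl ?_)
    simpa using (ZMod.natCast_eq_natCast_iff _ _ _).2 hc1

/-- Among the lifts `r + p * q * k` of a residue `r` coprime to `p * q`, exactly one lies in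
`Dset p q ℓ`. -/
theorem existsUnique_lift_mem_Dset {p q : ℕ} (hp : p.Prime) (hq : q.Prime) (hne : p ≠ q)
    (hdvd : p ∣ q - 1) (ℓ : ℕ) {r : ℕ} (hr : r < p * q) (hrc : r.Coprime (p * q)) :
    ∃! k, k < q ∧ r + p * q * k ∈ Dset p q ℓ := by
  have : Fact q.Prime := ⟨hq⟩
  have hcop : p.Coprime q := (Nat.coprime_primes hp hq).2 hne
  have hrq : r.Coprime q := hrc.coprime_mul_left_right
  have hpq : p < q := by
    have := Nat.le_of_dvd (Nat.sub_pos_of_lt hq.one_lt) hdvd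
    have := hq.one_lt
    omega
  have hr0 : (r : ZMod q) ≠ 0 := fun h =>
    hq.coprime_iff_not_dvd.1 hrq.symm ((ZMod.natCast_eq_zero_iff _ _).1 h)
  have hp0 : (p : ZMod q) ≠ 0 := fun h =>
    hq.coprime_iff_not_dvd.1 hcop.symm ((ZMod.natCast_eq_zero_iff _ _).1 h)
  set M := (p - 1) * (q - 1) with hM
  have hM0 : (M : ZMod q) ≠ 0 := fun h => by
    rcases (hq.dvd_mul).1 ((ZMod.natCast_eq_zero_iff _ _).1 h) with h | h
    · have := Nat.le_of_dvd (Nat.sub_pos_of_lt hp.one_lt) h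
      omega
    · have := Nat.le_of_dvd (Nat.sub_pos_of_lt hq.one_lt) h
      have := hq.one_lt
      omega
  obtain ⟨A, hA⟩ : (q : ℤ) ∣ (r : ℤ) ^ M - 1 := by
    rw [← ZMod.intCast_zmod_eq_zero_iff_dvd]
    push_cast
    rw [hM, mul_comm, pow_mul, ZMod.pow_card_sub_one_eq_one hr0, one_pow, sub_self]
  set B : ZMod q := M * r ^ (M - 1) * p with hB
  have hB0 : B ≠ 0 := mul_ne_zero (mul_ne_zero hM0 (pow_ne_zero _ hr0)) hp0
  have key : ∀ k : ℕ, k < q →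
      (r + p * q * k ∈ Dset p q ℓ ↔ (k : ZMod q) = (p ^ 2 * ℓ - A) / B) := by
    intro k hk
    rw [mem_Dset_iff hp hq hne hdvd, ← hM]
    have h1 : r + p * q * k < p * q ^ 2 := by nlinarith [Nat.mul_pos hp.pos hq.pos]
    have h2 : (r + p * q * k).Coprime (p * q) := by simpa using hrc
    rw [and_iff_right h1, and_iff_right h2]
    obtain ⟨z, hz⟩ := (Polynomial.powAddExpansion (r : ℤ) (p * q * k : ℤ) M)
    have e : ((r : ℤ) + p * q * k) ^ M - (1 + p ^ 2 * q * ℓ) =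
        q * (A + M * r ^ (M - 1) * p * k - p ^ 2 * ℓ + q * (z * p ^ 2 * k ^ 2)) := by
      linear_combination hz + hA
    have e2 : (((r + p * q * k : ℕ) : ZMod (q ^ 2)) ^ M = 1 + p ^ 2 * q * ℓ) ↔
        ((q ^ 2 : ℕ) : ℤ) ∣ ((r : ℤ) + p * q * k) ^ M - (1 + p ^ 2 * q * ℓ) := by
      rw [← ZMod.intCast_zmod_eq_zero_iff_dvd, ← sub_eq_zero]
      push_cast
      rfl
    have hqz : (q : ℤ) ≠ 0 := by exact_mod_cast hq.ne_zero
    rw [e2, e, Nat.cast_pow, pow_two, mul_dvd_mul_iff_left hqz,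
      ← ZMod.intCast_zmod_eq_zero_iff_dvd, eq_div_iff hB0, hB]
    push_cast
    rw [ZMod.natCast_self]
    constructor <;> intro h <;> linear_combination h
  refine ⟨((p ^ 2 * ℓ - A) / B : ZMod q).val, ⟨ZMod.val_lt _, ?_⟩, ?_⟩
  · exact (key _ (ZMod.val_lt _)).2 (ZMod.natCast_zmod_val _)
  · rintro k ⟨hk, hmem⟩
    rw [← (key k hk).1 hmem, ZMod.val_natCast_of_lt hk]

theorem sum_Dset_pow_eq_one {p q : ℕ} (hp : p.Prime) (hq : q.Prime) (hne : p ≠ q)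
    (hdvd : p ∣ q - 1) {K : Type*} [Field K] {ω : K} (hω : IsPrimitiveRoot ω (p * q)) (ℓ : ℕ) :
    ∑ u ∈ Dset p q ℓ, ω ^ u = 1 := by
  have hpq : 0 < p * q := Nat.mul_pos hp.pos hq.pos
  have hlt : ∀ u ∈ Dset p q ℓ, u / (p * q) < q := fun u hu => by
    rw [Nat.div_lt_iff_lt_mul hpq]
    have := ((mem_Dset_iff hp hq hne hdvd ℓ u).1 hu).1
    calc u < p * q ^ 2 := this
      _ = q * (p * q) := by ring
  have hcop : ∀ u ∈ Dset p q ℓ, (u % (p * q)).Coprime (p * q) := fun u hu =>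
    (Nat.mod_modEq u (p * q)).gcd_eq.trans ((mem_Dset_iff hp hq hne hdvd ℓ u).1 hu).2.1
  rw [← hω.sum_pow_filter_coprime_mul_primes hp hq hne]
  refine Finset.sum_nbij (· % (p * q)) ?_ ?_ ?_ ?_
  · intro u hu
    exact Finset.mem_filter.2 ⟨Finset.mem_range.2 (Nat.mod_lt _ hpq), hcop u hu⟩
  · intro a ha b hb hab
    simp only [Finset.mem_coe] at ha hb hab
    have h := (existsUnique_lift_mem_Dset hp hq hne hdvd ℓ (Nat.mod_lt a hpq) (hcop a ha)).unique
      (y₁ := a / (p * q)) (y₂ := b / (p * q)) ⟨hlt a ha, by rwa [Nat.mod_add_div]⟩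
      ⟨hlt b hb, by rwa [hab, Nat.mod_add_div]⟩
    rw [← Nat.mod_add_div a (p * q), ← Nat.mod_add_div b (p * q), hab, h]
  · intro r hr
    obtain ⟨hr, hrc⟩ := Finset.mem_filter.1 hr
    rw [Finset.mem_range] at hr
    obtain ⟨k, ⟨-, hk⟩, -⟩ := existsUnique_lift_mem_Dset hp hq hne hdvd ℓ hr hrc
    exact ⟨_, hk, by simp [Nat.mod_eq_of_lt hr]⟩
  · intro u _
    rw [hω.eq_orderOf, pow_mod_orderOf]

theorem stmt_12 (p q : ℕ) (hp : p.Prime) (hq : q.Prime) (hpodd : Odd p) (hqodd : Odd q)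
    (hne : p ≠ q) (hdvd : p ∣ q - 1) (K : Type*) [Field K] [CharP K 2] (γ : K)
    (hγ : IsPrimitiveRoot γ (p * q ^ 2)) (ℓ : ℕ) (hℓ : ℓ < q) (v : ℕ)
    (hv : v < p * q ^ 2) :
    (Nat.gcd v (p * q ^ 2) = q → ∑ u ∈ Dset p q ℓ, γ ^ (u * v) = 1) ∧
    (Nat.gcd v (p * q ^ 2) = p ∨ Nat.gcd v (p * q ^ 2) = p * q ∨
        Nat.gcd v (p * q ^ 2) = q ^ 2 →
      ∑ u ∈ Dset p q ℓ, γ ^ (u * v) = 0) := by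
  have hdvd_of_gcd : ∀ {a b : ℕ}, p * q ^ 2 ∣ a * b → Nat.gcd v (p * q ^ 2) = a →
      (γ ^ v) ^ b = 1 := by
    intro a b hab hg
    rw [← pow_mul, hγ.pow_eq_one_iff_dvd]
    exact hab.trans (mul_dvd_mul_right (hg ▸ Nat.gcd_dvd_left _ _) b)
  simp only [mul_comm _ v, pow_mul]
  refine ⟨fun hg => ?_, fun hg => ?_⟩
  · have hv0 : v ≠ 0 := by
      rintro rfl
      rw [Nat.gcd_zero_left] at hg
      nlinarith [hp.two_le, hq.two_le, Nat.mul_pos hp.pos hq.pos]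
    have hω : IsPrimitiveRoot (γ ^ v) (p * q) := by
      rw [IsPrimitiveRoot.iff_orderOf, orderOf_pow' γ hv0, ← hγ.eq_orderOf, Nat.gcd_comm, hg]
      exact Nat.div_eq_of_eq_mul_left hq.pos (by ring)
    exact sum_Dset_pow_eq_one hp hq hne hdvd hω ℓ
  · refine sum_Dset_pow_eq_zero hp hq hpodd hqodd hne hdvd ?_ ℓ
    rcases hg with hg | hg | hg
    · exact Or.inr (hdvd_of_gcd dvd_rfl hg)
    · exact Or.inr (hdvd_of_gcd ⟨q, by ring⟩ hg)
    · exact Or.inl (hdvd_of_gcd (mul_comm _ _).dvd hg)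
end
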